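/- arXiv:2403.10523 — 3 statements merged into one kernel-verified Lean document; each statement's English description precedes it below -/
import Mathlib

section
/- Let a be a real number and let K[a,∞) = {s ∈ ℂ : Re(s) ≥ a, Im(s) ≥ 0}. Suppose U ⊆ ℂ is an open connected set containing K[a,∞), and F : ℂ → ℂ is holomorphic on U and not identically zero on U. Assume: (i) Im(F(s)) does not change sign on the boundary of K[a,∞), i.e., either Im(F(a+it)) ≥ 0 for all t ≥ 0 and Im(F(x)) ≥ 0 for all real x ≥ a, or Im(F(a+it)) ≤ 0 for all t ≥ 0 and Im(F(x)) ≤ 0 for all real x ≥ a; and (ii) there is a constant C > 0 such that |F(σ+it)| ≤ C/(t+|σ|) for all σ+it ∈ K[a,∞) with t + |σ| > 0. Then F(s) ≠ 0 for every s with Re(s) > a and Im(s) > 0. -/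
open Complex

lemma quarterplane_aux
    (a : ℝ)
    (U : Set ℂ) (hU : IsOpen U) (hUconn : IsConnected U)
    (hKU : {s : ℂ | a ≤ s.re ∧ 0 ≤ s.im} ⊆ U)
    (F : ℂ → ℂ) (hF : DifferentiableOn ℂ F U)
    (hFne : ¬ ∀ z ∈ U, F z = 0)
    (h1 : ∀ t : ℝ, 0 ≤ t → 0 ≤ (F (a + t * I)).im) (h2 : ∀ x : ℝ, a ≤ x → 0 ≤ (F x).im)
    (C : ℝ) (hC : 0 < C)
    (hbound : ∀ σ t : ℝ, a ≤ σ → 0 ≤ t → 0 < t + |σ| →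
      ‖F (σ + t * I)‖ ≤ C / (t + |σ|)) :
    ∀ s : ℂ, a < s.re → 0 < s.im → F s ≠ 0 := by
  intro s hs1 hs2 hs0
  have hg : ∀ w : ℂ, ‖cexp (I * F w)‖ = Real.exp (-(F w).im) := by
    intro w
    rw [Complex.norm_exp]
    simp
  have hb : ∀ w : ℂ, a ≤ w.re → 0 ≤ w.im → 0 < w.im + |w.re| →
      ‖F w‖ ≤ C / (w.im + |w.re|) := by
    intro w hw1 hw2 hw3
    have := hbound w.re w.im hw1 hw2 hw3
    rwa [Complex.re_add_im] at this
  have hle : ∀ w : ℂ, a ≤ w.re → 0 ≤ w.im → ‖cexp (I * F w)‖ ≤ 1 := by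
    intro w hw1 hw2
    have key : ‖(fun z : ℂ => cexp (I * F (z + a))) (w - a)‖ ≤ 1 := by
      apply PhragmenLindelof.quadrant_I (f := fun z : ℂ => cexp (I * F (z + a)))
      · apply DifferentiableOn.diffContOnCl
        rw [closure_reProdIm, closure_Ioi]
        have hsh : DifferentiableOn ℂ (fun z : ℂ => F (z + a)) (Set.Ici 0 ×ℂ Set.Ici 0) := by
          refine hF.comp (g := F) (f := fun z : ℂ => z + a) (by fun_prop) ?_
          intro z hz
          rw [mem_reProdIm] at hz
          apply hKU
          have h3 := hz.1
          have h4 := hz.2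
          simp only [Set.mem_Ici] at h3 h4
          constructor <;> simp <;> assumption
        exact (hsh.const_mul I).cexp
      · refine ⟨0, by norm_num, 0, ?_⟩
        apply Asymptotics.IsBigO.of_bound (Real.exp C)
        rw [Filter.eventually_inf_principal]
        have : ∀ᶠ z : ℂ in Bornology.cobounded ℂ, 1 + |a| ≤ ‖z‖ :=
          tendsto_norm_cobounded_atTop.eventually_ge_atTop _
        filter_upwards [this] with z hz hzq
        rw [mem_reProdIm] at hzq
        have h3 : 0 < z.re := hzq.1
        have h4 : 0 < z.im := hzq.2
        rw [hg]
        simp only [zero_mul, Real.exp_zero, norm_one, mul_one]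
        apply Real.exp_le_exp.2
        have h5 : 1 ≤ (z + a).im + |(z + a).re| := by
          have e1 := Complex.norm_le_abs_re_add_abs_im z
          rw [abs_of_pos h3, abs_of_pos h4] at e1
          have e2 := le_abs_self (z.re + a)
          have e3 := neg_abs_le a
          simp
          linarith
        have h6 := hb (z + a) (by simp; exact h3.le) (by simp; exact h4.le) (by linarith)
        have h7 : C / ((z + a).im + |(z + a).re|) ≤ C := div_le_self hC.le h5
        have h8 := Complex.abs_im_le_norm (F (z + a))
        have h9 := neg_le_abs (F (z + a)).im
        linarith
      · intro x hx
        rw [hg]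
        have := h2 (x + a) (by linarith)
        push_cast at this
        simpa using this
      · intro x hx
        rw [hg]
        have := h1 x hx
        rw [add_comm] at this
        simpa using this
      · simpa using hw1
      · simpa using hw2
    simpa using key
  let Q : Set ℂ := Set.Ioi a ×ℂ Set.Ioi 0
  have hQo : IsOpen Q := isOpen_Ioi.reProdIm isOpen_Ioi
  have hQc : IsPreconnected Q := ((convex_halfSpace_re_gt a).inter (convex_halfSpace_im_gt 0)).isPreconnected
  have hQU : Q ⊆ U := fun z hz => hKU ⟨le_of_lt hz.1, le_of_lt hz.2⟩
  have heq := Complex.eqOn_of_isPreconnected_of_isMaxOn_norm (f := fun z => cexp (I * F z))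
    (c := s) hQc hQo (((hF.mono hQU).const_mul I).cexp) ⟨hs1, hs2⟩ (by
      intro z hz
      have := hle z (le_of_lt hz.1) (le_of_lt hz.2)
      simpa [hs0] using this)
  have hz0 : ∀ z : ℂ, a < z.re → C < z.im → F z = 0 := by
    intro z hz1 hz2
    have e := heq (show z ∈ Q from ⟨hz1, hC.trans hz2⟩)
    simp only [Function.const, hs0, mul_zero, Complex.exp_zero] at e
    obtain ⟨n, hn⟩ := Complex.exp_eq_one_iff.1 e
    have hpos : C < z.im + |z.re| := by have := abs_nonneg z.re; linarith
    have h6 := hb z hz1.le (hC.trans hz2).le (hC.trans hpos)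
    have h7 : C / (z.im + |z.re|) < 1 := (div_lt_one (hC.trans hpos)).2 hpos
    have h8 : ‖F z‖ = |(n : ℝ)| * (2 * Real.pi) := by
      have := congrArg norm hn
      simpa [abs_of_pos Real.pi_pos] using this
    by_cases hn0 : n = 0
    · simpa [hn0] using hn
    · exfalso
      have h9 : (1 : ℝ) ≤ |(n : ℝ)| := by
        exact_mod_cast Int.one_le_abs hn0
      have := Real.pi_gt_three
      nlinarith
  apply hFne
  have han := hF.analyticOnNhd hU
  let z₀ : ℂ := ⟨a + 1, C + 1⟩
  have hz₀ : F =ᶠ[nhds z₀] 0 := by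
    have ho : IsOpen (Set.Ioi a ×ℂ Set.Ioi C) := isOpen_Ioi.reProdIm isOpen_Ioi
    filter_upwards [ho.mem_nhds (show z₀ ∈ Set.Ioi a ×ℂ Set.Ioi C from
      ⟨by simp [z₀], by simp [z₀]⟩)] with z hz
    exact hz0 z hz.1 hz.2
  exact fun z hz => han.eqOn_zero_of_preconnected_of_eventuallyEq_zero hUconn.isPreconnected
    (hKU ⟨by simp [z₀], by simp [z₀]; linarith⟩) hz₀ hz

theorem zero_free_quarterplane_of_im_sign_boundary
    (a : ℝ)
    (U : Set ℂ) (hU : IsOpen U) (hUconn : IsConnected U)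
    (hKU : {s : ℂ | a ≤ s.re ∧ 0 ≤ s.im} ⊆ U)
    (F : ℂ → ℂ) (hF : DifferentiableOn ℂ F U)
    (hFne : ¬ ∀ z ∈ U, F z = 0)
    (hsign :
      ((∀ t : ℝ, 0 ≤ t → 0 ≤ (F (a + t * I)).im) ∧ (∀ x : ℝ, a ≤ x → 0 ≤ (F x).im)) ∨
      ((∀ t : ℝ, 0 ≤ t → (F (a + t * I)).im ≤ 0) ∧ (∀ x : ℝ, a ≤ x → (F x).im ≤ 0)))
    (C : ℝ) (hC : 0 < C)
    (hbound : ∀ σ t : ℝ, a ≤ σ → 0 ≤ t → 0 < t + |σ| →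
      ‖F (σ + t * I)‖ ≤ C / (t + |σ|)) :
    ∀ s : ℂ, a < s.re → 0 < s.im → F s ≠ 0 := by
  rcases hsign with ⟨h1, h2⟩ | ⟨h1, h2⟩
  · exact quarterplane_aux a U hU hUconn hKU F hF hFne h1 h2 C hC hbound
  · intro s hs1 hs2 hs0
    refine quarterplane_aux a U hU hUconn hKU (fun z => -F z) hF.neg (by simpa using hFne)
      (by simpa using h1) (by simpa using h2) C hC (by simpa using hbound) s hs1 hs2 (by simpa using hs0)
end

section
/- Let ψ(s) = π^{s−1/2} · Γ((1−s)/2) / Γ(s/2), where Γ is the complex Gamma function. Then for every fixed real σ ≥ 1/2, |ψ(σ+it)| = O(t^{1/2−σ}) as t → ∞; that is, there exist constants C > 0 and T > 0 such that |ψ(σ+it)| ≤ C · t^{1/2−σ} for all t ≥ T. -/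
open Complex Real

noncomputable def psiAux (s : ℂ) : ℂ :=
  (Real.pi : ℂ) ^ (s - 1/2) * Complex.Gamma ((1 - s) / 2) / Complex.Gamma (s / 2)

lemma psi_aux_term (a τ x : ℝ) (hx : 0 ≤ x) (hτ : |a| + 1 ≤ τ) :
    0 < (a + x)^2 + τ^2 ∧ (2*x+1/2) / ((a+x)^2+τ^2) ≤
      Real.log ((x+1)^2+τ^2) - Real.log (x^2+τ^2) + 8*(1+|a|)*(2+|a|) * (1/(x+1)^2) := by
  set A := |a| with hA
  have hA0 : 0 ≤ A := abs_nonneg a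
  have h1 : a ≤ A := le_abs_self a
  have h2 : -A ≤ a := neg_abs_le a
  have hsq : a^2 = A^2 := (sq_abs a).symm
  have hτ0 : 0 < τ := by linarith
  have hτ2 : A^2 + 1 ≤ τ^2 := by nlinarith
  have hD : (x+1)^2/4 ≤ (a+x)^2+τ^2 := by nlinarith [sq_nonneg (x+2*a), sq_nonneg (x-1)]
  have hx1 : 0 < (x+1)^2 := by positivity
  have hDpos : 0 < (a+x)^2+τ^2 := by linarith
  refine ⟨hDpos, ?_⟩
  have hE0 : 0 < x^2+τ^2 := by positivity
  have hE : 0 < (x+1)^2+τ^2 := by positivity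
  have hlog : (2*x+1)/((x+1)^2+τ^2) ≤ Real.log ((x+1)^2+τ^2) - Real.log (x^2+τ^2) := by
    rw [← Real.log_div hE.ne' hE0.ne']
    have := Real.one_sub_inv_le_log_of_pos (div_pos hE hE0)
    refine le_trans (le_of_eq ?_) this
    field_simp
    ring
  have hED : ((x+1)^2+τ^2) - ((a+x)^2+τ^2) ≤ (1+A)*(2+A)*(x+1) := by
    have e : ((x+1)^2+τ^2) - ((a+x)^2+τ^2) = (1-a)*(2*x+1+a) := by ring
    rw [e]
    have : (1-a)*(2*x+1+a) ≤ (1+A)*(2*x+1+A) := by nlinarith [mul_nonneg hA0 hx]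
    nlinarith [mul_nonneg hA0 hx, mul_nonneg (mul_nonneg hA0 hx) hA0]
  have hd : (2*x+1/2) / ((a+x)^2+τ^2) - (2*x+1)/((x+1)^2+τ^2)
      ≤ 8*(1+A)*(2+A) * (1/(x+1)^2) := by
    set D := (a+x)^2+τ^2
    set E := (x+1)^2+τ^2 with hEd
    have hEx : (x+1)^2 ≤ E := by rw [hEd]; nlinarith
    calc (2*x+1/2) / D - (2*x+1)/E ≤ (2*x+1) / D - (2*x+1)/E := by gcongr; norm_num
      _ = (2*x+1)*(E-D)/(D*E) := by field_simp
      _ ≤ (2*(x+1))*((1+A)*(2+A)*(x+1))/(D*E) := by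
          apply div_le_div_of_nonneg_right _ (by positivity)
          apply le_trans (mul_le_mul_of_nonneg_left hED (by positivity))
          gcongr; linarith
      _ ≤ (2*(x+1))*((1+A)*(2+A)*(x+1))/((x+1)^2/4*(x+1)^2) := by gcongr
      _ = 8*(1+A)*(2+A) * (1/(x+1)^2) := by field_simp; ring
  linarith

lemma psi_aux_gamma (a b c : ℝ) (hc : 0 ≤ c) (hab : b - a = c) (hs : a + b = 1/2) :
    ∃ K : ℝ, ∀ τ : ℝ, |a| + 1 ≤ τ →
      ‖Complex.Gamma (a - τ * I)‖ ≤
        Real.exp (c/2 * (- (2 * Real.log τ) + K)) * ‖Complex.Gamma (b + τ * I)‖ := by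
  set M := 8*(1+|a|)*(2+|a|) with hM
  have hM0 : 0 ≤ M := by positivity
  have hsum : Summable (fun j : ℕ => 1/((j:ℝ)+1)^2) := by
    have := (summable_nat_add_iff 1).2 (Real.summable_one_div_nat_pow.2 (by norm_num : 1 < 2))
    simpa using this
  set S := ∑' j : ℕ, 1/((j:ℝ)+1)^2 with hS
  refine ⟨M*S, fun τ hτ => ?_⟩
  have hτ0 : 0 < τ := by linarith [abs_nonneg a]
  set z1 : ℂ := a - τ * I with hz1
  set z2 : ℂ := b + τ * I with hz2
  have n1 (j : ℕ) : ‖z1 + j‖^2 = (a+j)^2+τ^2 := by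
    rw [← Complex.normSq_eq_norm_sq, Complex.normSq_apply]; simp [hz1]; ring
  have n2 (j : ℕ) : ‖z2 + j‖^2 = (b+j)^2+τ^2 := by
    rw [← Complex.normSq_eq_norm_sq, Complex.normSq_apply]; simp [hz2]; ring
  let v : ℕ → ℝ := fun j => Real.log (((j:ℝ)+1)^2+τ^2) - Real.log ((j:ℝ)^2+τ^2) + M * (1/((j:ℝ)+1)^2)
  have p1 (j : ℕ) : 0 < ‖z1 + j‖ := by
    have := (psi_aux_term a τ j (by positivity) hτ).1
    rw [← n1] at this
    by_contra h
    have h0 : ‖z1 + j‖ = 0 := le_antisymm (not_lt.1 h) (norm_nonneg _)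
    rw [h0] at this; norm_num at this
  have step (j : ℕ) : ‖z2 + j‖ ≤ ‖z1 + j‖ * Real.exp (c/2 * v j) := by
    obtain ⟨hD, hv⟩ := psi_aux_term a τ j (by positivity) hτ
    refine (sq_le_sq₀ (norm_nonneg _) (by positivity)).1 ?_
    rw [mul_pow, n1, n2, ← Real.exp_nat_mul]
    have e : ((2:ℕ):ℝ) * (c/2 * v j) = c * v j := by push_cast; ring
    rw [e]
    have h1 : (b+j)^2+τ^2 = ((a+j)^2+τ^2) * (c * ((2*(j:ℝ)+1/2) / ((a+j)^2+τ^2)) + 1) := by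
      field_simp
      rw [← hab]
      linear_combination 2 * (b-a) * hs
    rw [h1]
    gcongr
    refine (Real.add_one_le_exp _).trans ?_
    gcongr
  have vsum (n : ℕ) : ∑ j ∈ Finset.range (n+1), v j ≤
      Real.log (((n:ℝ)+1)^2+τ^2) - 2 * Real.log τ + M * S := by
    have h1 : ∑ j ∈ Finset.range (n+1), (Real.log (((j:ℝ)+1)^2+τ^2) - Real.log ((j:ℝ)^2+τ^2))
        = Real.log (((n:ℝ)+1)^2+τ^2) - 2 * Real.log τ := by
      have := Finset.sum_range_sub (fun j : ℕ => Real.log ((j:ℝ)^2+τ^2)) (n+1)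
      push_cast at this
      rw [this]
      simp
    have h2 : ∑ j ∈ Finset.range (n+1), 1/((j:ℝ)+1)^2 ≤ S :=
      hsum.sum_le_tsum _ (fun j _ => by positivity)
    simp only [v]
    rw [Finset.sum_add_distrib, h1, ← Finset.mul_sum]
    gcongr
  have prod (n : ℕ) : ∏ j ∈ Finset.range (n+1), ‖z2 + j‖ ≤
      (∏ j ∈ Finset.range (n+1), ‖z1 + j‖) *
        Real.exp (c/2 * (Real.log (((n:ℝ)+1)^2+τ^2) - 2 * Real.log τ + M * S)) := by
    calc _ ≤ ∏ j ∈ Finset.range (n+1), (‖z1 + j‖ * Real.exp (c/2 * v j)) :=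
          Finset.prod_le_prod (fun _ _ => norm_nonneg _) (fun j _ => step j)
      _ = (∏ j ∈ Finset.range (n+1), ‖z1 + j‖) * Real.exp (c/2 * ∑ j ∈ Finset.range (n+1), v j) := by
          rw [Finset.prod_mul_distrib, ← Real.exp_sum, ← Finset.mul_sum]
      _ ≤ _ := by
          gcongr
          exact vsum n
  have p2 (j : ℕ) : 0 < ‖z2 + j‖ := by
    have : 0 < ‖z2 + j‖^2 := by rw [n2]; positivity
    by_contra h
    have h0 : ‖z2 + j‖ = 0 := le_antisymm (not_lt.1 h) (norm_nonneg _)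
    rw [h0] at this; norm_num at this
  have seq : ∀ n : ℕ, 0 < n → ‖Complex.GammaSeq z1 n‖ ≤
      Real.exp (c/2 * (Real.log ((((n:ℝ)+1)^2+τ^2)/(n:ℝ)^2) - 2 * Real.log τ + M * S))
        * ‖Complex.GammaSeq z2 n‖ := by
    intro n hn
    have hn' : (0:ℝ) < n := by exact_mod_cast hn
    have P1 : 0 < ∏ j ∈ Finset.range (n+1), ‖z1 + j‖ := Finset.prod_pos (fun j _ => p1 j)
    have P2 : 0 < ∏ j ∈ Finset.range (n+1), ‖z2 + j‖ := Finset.prod_pos (fun j _ => p2 j)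
    have hp := prod n
    have hpow : (n:ℝ)^a = Real.exp (-(c * Real.log n)) * (n:ℝ)^b := by
      rw [Real.rpow_def_of_pos hn', Real.rpow_def_of_pos hn', ← Real.exp_add, ← hab]
      congr 1; ring
    have r1 : z1.re = a := by simp [hz1]
    have r2 : z2.re = b := by simp [hz2]
    rw [Complex.GammaSeq, Complex.GammaSeq, norm_div, norm_div, norm_mul, norm_mul, norm_prod,
      norm_prod, Complex.norm_natCast_cpow_of_pos hn, Complex.norm_natCast_cpow_of_pos hn, r1, r2,
      hpow, Real.log_div (by positivity) (by positivity), Real.log_pow]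
    set L := Real.log (((n:ℝ)+1)^2+τ^2)
    have e : Real.exp (c/2 * (L - ((2:ℕ):ℝ) * Real.log n - 2 * Real.log τ + M * S)) =
       Real.exp (-(c * Real.log n)) * Real.exp (c/2 * (L - 2 * Real.log τ + M * S)) := by
      rw [← Real.exp_add]; congr 1; push_cast; ring
    rw [e, ← mul_div_assoc, div_le_div_iff₀ P1 P2]
    have := mul_le_mul_of_nonneg_left hp (by positivity :
      0 ≤ Real.exp (-(c * Real.log n)) * (n:ℝ)^b * ‖((n.factorial : ℕ) : ℂ)‖)
    refine this.trans (le_of_eq ?_)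
    ring
  have lim : Filter.Tendsto (fun n : ℕ => (((n:ℝ)+1)^2+τ^2)/(n:ℝ)^2) Filter.atTop (nhds 1) := by
    have h := tendsto_inv_atTop_nhds_zero_nat (𝕜 := ℝ)
    have h2 : Filter.Tendsto (fun n : ℕ => (1 + (n:ℝ)⁻¹)^2 + τ^2 * ((n:ℝ)⁻¹)^2) Filter.atTop
        (nhds ((1+0)^2 + τ^2 * 0^2)) := ((h.const_add 1).pow 2).add ((h.pow 2).const_mul _)
    have e : ((1:ℝ)+0)^2 + τ^2 * 0^2 = 1 := by norm_num
    rw [e] at h2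
    refine h2.congr' ?_
    filter_upwards [Filter.eventually_gt_atTop 0] with n hn
    have hn' : (0:ℝ) < n := by exact_mod_cast hn
    field_simp
  have lim2 := (((((Real.continuousAt_log one_ne_zero).tendsto.comp lim).sub_const
    (2 * Real.log τ)).add_const (M * S)).const_mul (c/2)).rexp.mul (GammaSeq_tendsto_Gamma z2).norm
  rw [Real.log_one, zero_sub] at lim2
  refine le_of_tendsto_of_tendsto (GammaSeq_tendsto_Gamma z1).norm lim2 ?_
  filter_upwards [Filter.eventually_gt_atTop 0] with n hn
  exact seq n hn

theorem psi_bigO (σ : ℝ) (hσ : 1/2 ≤ σ) :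
    ∃ C : ℝ, 0 < C ∧ ∃ T : ℝ, 0 < T ∧ ∀ t : ℝ, T ≤ t →
      ‖psiAux (σ + t * I)‖ ≤ C * t ^ (1/2 - σ) := by
  obtain ⟨K, hK⟩ := psi_aux_gamma ((1-σ)/2) (σ/2) (σ-1/2) (by linarith) (by ring) (by ring)
  refine ⟨Real.pi ^ (σ-1/2) * Real.exp ((σ-1/2)/2 * (2 * Real.log 2 + K)), by positivity,
    2 * (|(1-σ)/2| + 1), by positivity, fun t ht => ?_⟩
  have ht0 : 0 < t := by linarith [abs_nonneg ((1-σ)/2)]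
  have h := hK (t/2) (by linarith)
  have e1 : (1 - ((σ:ℂ) + t * I))/2 = ((((1-σ)/2 : ℝ)) : ℂ) - ((t/2 : ℝ) : ℂ) * I := by
    push_cast; ring
  have e2 : ((σ:ℂ) + t * I)/2 = (((σ/2 : ℝ)) : ℂ) + ((t/2 : ℝ) : ℂ) * I := by
    push_cast; ring
  have e3 : ((σ:ℂ) + t * I - 1/2).re = σ - 1/2 := by
    simp
  rw [psiAux, norm_div, norm_mul, Complex.norm_cpow_eq_rpow_re_of_pos Real.pi_pos, e3, e1, e2]
  apply div_le_of_le_mul₀ (norm_nonneg _) (by positivity)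
  have e4 : Real.exp ((σ-1/2)/2 * (-(2 * Real.log (t/2)) + K)) =
      Real.exp ((σ-1/2)/2 * (2 * Real.log 2 + K)) * t ^ (1/2 - σ) := by
    rw [Real.rpow_def_of_pos ht0, ← Real.exp_add, Real.log_div ht0.ne' two_ne_zero]
    congr 1; ring
  rw [e4] at h
  calc _ ≤ Real.pi ^ (σ-1/2) * _ := mul_le_mul_of_nonneg_left h (by positivity)
    _ = _ := by ring
end

section
/- There exists a constant C > 0 such that for all s ∈ ℂ with Re(s) ≥ 1/2 and Im(s) ≥ π, one has |ζ(s)| ≤ C·(Im(s))^{1/4}, where ζ is the Riemann zeta function. -/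
open Complex

lemma zb_kl_abs (u : ℕ → ℂ) (q : ℕ → ℝ) (Q : ℝ) (m : ℕ) (hu : ∀ n, ‖u n‖ ≤ 1)
    (hc : ∀ n ≤ m, (u n - u (n+1)) * ((1 - I * q n) / 2) = u n)
    (hq : ∀ n < m, q n ≤ q (n+1)) (hQ : ∀ n ≤ m, |q n| ≤ Q) :
    ‖∑ n ∈ Finset.range (m+1), u n‖ ≤ 1 + 2 * Q := by
  have hcn : ∀ n ≤ m, ‖((1 - I * q n) / 2 : ℂ)‖ ≤ (1 + Q) / 2 := by
    intro n hn
    rw [norm_div, Complex.norm_ofNat]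
    have : ‖(1 - I * q n : ℂ)‖ ≤ 1 + |q n| := by
      refine (norm_sub_le _ _).trans ?_
      simp
    have := hQ n hn
    linarith
  have key : ∀ j ≤ m, ‖∑ n ∈ Finset.range (j+1), u n + u (j+1) * ((1 - I * q j) / 2)‖ ≤
      (1 + Q) / 2 + (q j - q 0) / 2 := by
    intro j
    induction j with
    | zero =>
      intro h
      have h0 := hc 0 h
      have : ∑ n ∈ Finset.range (0+1), u n + u (0+1) * ((1 - I * q 0) / 2) =
          u 0 * ((1 - I * q 0) / 2) := by
        simp only [zero_add, Finset.range_one, Finset.sum_singleton] at *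
        linear_combination -h0
      rw [this, norm_mul]
      have := hcn 0 h
      have h1 := hu 0
      have h2 := norm_nonneg ((1 - I * q 0) / 2 : ℂ)
      nlinarith
    | succ j ih =>
      intro h
      have h0 := hc (j+1) h
      have h1 := ih (by omega)
      have : ∑ n ∈ Finset.range (j+1+1), u n + u (j+1+1) * ((1 - I * q (j+1)) / 2) =
          (∑ n ∈ Finset.range (j+1), u n + u (j+1) * ((1 - I * q j) / 2)) +
          u (j+1) * (-I * ((q (j+1) - q j : ℝ) : ℂ) / 2) := by
        rw [Finset.sum_range_succ _ (j+1)]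
        push_cast
        linear_combination -h0
      rw [this]
      refine (norm_add_le _ _).trans ?_
      have h3 : ‖u (j+1) * (-I * ((q (j+1) - q j : ℝ) : ℂ) / 2)‖ ≤ (q (j+1) - q j) / 2 := by
        have hm := hq j (by omega)
        rw [norm_mul, norm_div, norm_mul, norm_neg, norm_I, norm_real, Real.norm_eq_abs,
          abs_of_nonneg (by linarith), Complex.norm_ofNat]
        have := hu (j+1)
        nlinarith
      linarith
  have k1 := key m le_rfl
  have k2 : ‖u (m+1) * ((1 - I * q m) / 2)‖ ≤ (1 + Q) / 2 := by
    rw [norm_mul]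
    have := hcn m le_rfl
    have h1 := hu (m+1)
    have h2 := norm_nonneg ((1 - I * q m) / 2 : ℂ)
    nlinarith
  have k3 := abs_le.1 (hQ m le_rfl)
  have k4 := abs_le.1 (hQ 0 (Nat.zero_le _))
  have k5 := norm_sub_le (∑ n ∈ Finset.range (m+1), u n + u (m+1) * ((1 - I * q m) / 2))
    (u (m+1) * ((1 - I * q m) / 2))
  rw [add_sub_cancel_right] at k5
  linarith

lemma zb_abel (u : ℕ → ℂ) (w : ℕ → ℝ) (K : ℝ) (m : ℕ)
    (hw : ∀ n < m, w (n+1) ≤ w n) (hw0 : 0 ≤ w m)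
    (hK : ∀ j ≤ m, ‖∑ n ∈ Finset.range (j+1), u n‖ ≤ K) :
    ‖∑ n ∈ Finset.range (m+1), (w n : ℂ) * u n‖ ≤ w 0 * K := by
  have key : ∀ j ≤ m, ‖∑ n ∈ Finset.range (j+1), (w n : ℂ) * u n -
      w j * ∑ n ∈ Finset.range (j+1), u n‖ ≤ (w 0 - w j) * K := by
    intro j
    induction j with
    | zero => intro h; simp
    | succ j ih =>
      intro h
      have h1 := ih (by omega)
      have : ∑ n ∈ Finset.range (j+1+1), (w n : ℂ) * u n -
          w (j+1) * ∑ n ∈ Finset.range (j+1+1), u n =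
          (∑ n ∈ Finset.range (j+1), (w n : ℂ) * u n -
          w j * ∑ n ∈ Finset.range (j+1), u n) +
          ((w j - w (j+1) : ℝ) : ℂ) * ∑ n ∈ Finset.range (j+1), u n := by
        rw [Finset.sum_range_succ _ (j+1), Finset.sum_range_succ _ (j+1)]
        push_cast
        ring
      rw [this]
      refine (norm_add_le _ _).trans ?_
      have hm := hw j (by omega)
      have h2 := hK j (by omega)
      rw [norm_mul, norm_real, Real.norm_eq_abs, abs_of_nonneg (by linarith)]
      nlinarith
  have k1 := key m le_rfl
  have k2 := hK m le_rfl
  have k3 : ‖(w m : ℂ) * ∑ n ∈ Finset.range (m+1), u n‖ ≤ w m * K := by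
    rw [norm_mul, norm_real, Real.norm_eq_abs, abs_of_nonneg hw0]
    gcongr
  have := norm_add_le (∑ n ∈ Finset.range (m+1), (w n : ℂ) * u n -
      w m * ∑ n ∈ Finset.range (m+1), u n) (w m * ∑ n ∈ Finset.range (m+1), u n)
  rw [sub_add_cancel] at this
  linarith

lemma zb_sin_lb {θ δ : ℝ} (hδ : 0 < δ) (h1 : δ ≤ θ) (h2 : θ ≤ 1 - δ) :
    2 * δ ≤ Real.sin (Real.pi * θ) := by
  have hp := Real.pi_pos
  rcases le_total θ (1/2) with h | h
  · have := Real.mul_le_sin (x := Real.pi * θ) (mul_nonneg hp.le (by linarith)) (by nlinarith)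
    have e : 2 / Real.pi * (Real.pi * θ) = 2 * θ := by field_simp
    linarith
  · have := Real.mul_le_sin (x := Real.pi * (1 - θ)) (by apply mul_nonneg <;> linarith)
      (by nlinarith)
    have e : 2 / Real.pi * (Real.pi * (1-θ)) = 2 * (1-θ) := by field_simp
    have e2 : Real.pi * (1 - θ) = Real.pi - Real.pi * θ := by ring
    rw [e, e2, Real.sin_pi_sub] at this
    linarith

lemma zb_cot_mono {a b : ℝ} (h0 : 0 < a) (hab : a ≤ b) (h1 : b < 1) :
    Real.cos (Real.pi * b) / Real.sin (Real.pi * b) ≤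
      Real.cos (Real.pi * a) / Real.sin (Real.pi * a) := by
  have hp := Real.pi_pos
  have sa : 0 < Real.sin (Real.pi * a) := Real.sin_pos_of_pos_of_lt_pi (by positivity) (by nlinarith)
  have sb : 0 < Real.sin (Real.pi * b) := Real.sin_pos_of_pos_of_lt_pi (by nlinarith) (by nlinarith)
  rw [div_le_div_iff₀ sb sa]
  have : 0 ≤ Real.sin (Real.pi * b - Real.pi * a) :=
    Real.sin_nonneg_of_nonneg_of_le_pi (by nlinarith) (by nlinarith)
  rw [Real.sin_sub] at this
  nlinarith

lemma zb_c_id (α : ℝ) (h : Real.sin α ≠ 0) :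
    (1 - cexp (-(2 * α) * I)) * ((1 - I * ((Real.cos α / Real.sin α : ℝ) : ℂ)) / 2) = 1 := by
  have h' : Complex.sin α ≠ 0 := by rw [← ofReal_sin]; exact_mod_cast h
  have e : cexp (-(2 * α) * I) = (Complex.cos α - Complex.sin α * I)^2 := by
    have : Complex.cos α - Complex.sin α * I = cexp (-α * I) := by
      rw [Complex.exp_mul_I, Complex.cos_neg, Complex.sin_neg]; ring
    rw [this, ← Complex.exp_nat_mul]; congr 1; push_cast; ring
  rw [e]
  push_cast
  have h2 := Complex.sin_sq_add_cos_sq (α : ℂ)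
  have h3 := I_sq
  field_simp
  set S := Complex.sin (α:ℂ)
  set D := Complex.cos (α:ℂ)
  have : (1 - (D - S * I)^2) = 2 * S * (S + D * I) := by
    linear_combination (-1 : ℂ) * h2 - S^2 * h3
  rw [this]
  linear_combination 2 * S * h2 - 2 * S * D^2 * h3

/-- Kusmin-Landau on an interval, for the sums `∑ n^{-s}`. -/
lemma zb_kl (s : ℂ) (hs : 0 ≤ s.re) (δ : ℝ) (hδ : 0 < δ) (k : ℕ) (a m : ℕ) (ha : 1 ≤ a)
    (ht : 0 ≤ s.im)
    (hg : ∀ n ∈ Finset.Icc a (a + m), k + δ ≤ s.im / (2 * Real.pi) * Real.log (1 + 1 / n) ∧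
      s.im / (2 * Real.pi) * Real.log (1 + 1 / n) ≤ k + 1 - δ) :
    ‖∑ n ∈ Finset.Icc a (a + m), (n : ℂ) ^ (-s)‖ ≤ (a : ℝ) ^ (-s.re) * (1 + 1 / δ) := by
  have hp := Real.pi_pos
  set g : ℕ → ℝ := fun n => s.im / (2 * Real.pi) * Real.log (1 + 1 / n) with hgdef
  have hre : Finset.Icc a (a+m) = (Finset.range (m+1)).image (fun i => a + i) := by
    ext x; simp only [Finset.mem_Icc, Finset.mem_image, Finset.mem_range]
    constructor
    · intro h; exact ⟨x - a, by omega, by omega⟩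
    · rintro ⟨i, hi, rfl⟩; omega
  have hsum : ∑ n ∈ Finset.Icc a (a + m), (n : ℂ) ^ (-s) =
      ∑ i ∈ Finset.range (m+1), (((a + i : ℕ) : ℝ) ^ (-s.re) : ℝ) *
        (((a + i : ℕ) : ℂ) ^ (-(s.im : ℂ) * I)) := by
    rw [hre, Finset.sum_image (by intro x _ y _ h; simpa using h)]
    apply Finset.sum_congr rfl
    intro i _
    have hne : ((a + i : ℕ) : ℂ) ≠ 0 := by exact_mod_cast (by omega : a + i ≠ 0)
    rw [ofReal_cpow (by positivity), ofReal_natCast, ← Complex.cpow_add _ _ hne]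
    congr 1
    conv_lhs => rw [← re_add_im s]
    push_cast; ring
  have hgq : ∀ i ≤ m, δ ≤ g (a+i) - k ∧ g (a + i) - k ≤ 1 - δ := by
    intro i hi
    have := hg (a+i) (by simp; omega)
    constructor
    · have := this.1; simp only [hgdef]; linarith
    · have := this.2; simp only [hgdef]; linarith
  rw [hsum]
  refine zb_abel _ (fun i => ((a + i : ℕ) : ℝ) ^ (-s.re)) (1 + 1/δ) m ?_ (by positivity) ?_
  · intro n _
    apply Real.rpow_le_rpow_of_nonpos
    · exact_mod_cast (by omega)
    · push_cast; linarith
    · linarith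
  · intro j hj
    have := zb_kl_abs (fun i => ((a + i : ℕ) : ℂ) ^ (-(s.im : ℂ) * I))
      (fun i => Real.cos (Real.pi * (g (a+i) - k)) / Real.sin (Real.pi * (g (a+i) - k)))
      (1/(2*δ)) j ?_ ?_ ?_ ?_
    · refine this.trans (le_of_eq ?_); field_simp
    · intro n
      rw [Complex.norm_natCast_cpow_of_pos (by omega)]
      simp
    · intro n hn
      have hsin := zb_sin_lb hδ (hgq n (by omega)).1 (hgq n (by omega)).2
      have hid := zb_c_id (Real.pi * (g (a+n) - k)) (by linarith)
      have hstep : ((a + (n+1) : ℕ) : ℂ) ^ (-(s.im : ℂ) * I) =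
          ((a + n : ℕ) : ℂ) ^ (-(s.im : ℂ) * I) *
          cexp (-(2 * ((Real.pi * (g (a+n) - k) : ℝ) : ℂ)) * I) := by
        have hne : ((a + n : ℕ) : ℂ) ≠ 0 := by exact_mod_cast (by omega : a + n ≠ 0)
        have hne2 : ((a + (n+1) : ℕ) : ℂ) ≠ 0 := by exact_mod_cast (by omega : a + (n+1) ≠ 0)
        rw [Complex.cpow_def_of_ne_zero hne, Complex.cpow_def_of_ne_zero hne2, ← Complex.exp_add]
        have hlog : Real.log (1 + 1 / ((a+n : ℕ) : ℝ)) =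
            Real.log ((a + (n+1) : ℕ) : ℝ) - Real.log ((a+n : ℕ) : ℝ) := by
          have p1 : (0:ℝ) < ((a+n : ℕ) : ℝ) := by exact_mod_cast (by omega)
          rw [← Real.log_div (Nat.cast_ne_zero.2 (by omega)) p1.ne']
          congr 1
          field_simp; push_cast; ring
        rw [Complex.exp_eq_exp_iff_exists_int]
        refine ⟨-k, ?_⟩
        rw [← natCast_log, ← natCast_log]
        simp only [hgdef]
        rw [hlog]
        push_cast
        have : (Real.pi : ℂ) ≠ 0 := by exact_mod_cast hp.ne'
        field_simp
        ring
      rw [hstep]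
      linear_combination (((a + n : ℕ) : ℂ) ^ (-(s.im : ℂ) * I)) * hid
    · intro n hn
      have h1 := hgq n (by omega)
      have h2 := hgq (n+1) (by omega)
      apply zb_cot_mono (by linarith) _ (by linarith)
      have : g (a + (n+1)) ≤ g (a+n) := by
        simp only [hgdef]
        have p1 : (0:ℝ) < ((a+n : ℕ) : ℝ) := by exact_mod_cast (by omega)
        gcongr
        omega
      linarith
    · intro n hn
      have hsin := zb_sin_lb hδ (hgq n (by omega)).1 (hgq n (by omega)).2
      rw [abs_div, abs_of_pos (by linarith : 0 < Real.sin (Real.pi * (g (a+n) - k)))]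
      gcongr
      exact Real.abs_cos_le_one _

lemma zb_card (F : Finset ℕ) (x y : ℝ) (hxy : x ≤ y + 1) (h : ∀ n ∈ F, x ≤ n ∧ (n:ℝ) ≤ y) :
    (F.card : ℝ) ≤ y - x + 1 := by
  rcases F.eq_empty_or_nonempty with rfl | hne
  · simp; linarith
  · have hs : F ⊆ Finset.Icc (F.min' hne) (F.max' hne) := by
      intro n hn
      exact Finset.mem_Icc.2 ⟨F.min'_le n hn, F.le_max' n hn⟩
    have h1 := Finset.card_le_card hs
    rw [Nat.card_Icc] at h1
    have h2 := (h _ (F.min'_mem hne)).1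
    have h3 := (h _ (F.max'_mem hne)).2
    have h4 : F.min' hne ≤ F.max' hne := F.min'_le _ (F.max'_mem hne)
    have h5 : F.card + F.min' hne ≤ F.max' hne + 1 := by omega
    have h6 : (F.card : ℝ) + (F.min' hne : ℕ) ≤ (F.max' hne : ℕ) + 1 := by exact_mod_cast h5
    linarith

lemma zb_good (s : ℂ) (hs : 0 ≤ s.re) (δ : ℝ) (hδ : 0 < δ) (k : ℕ) (J : Finset ℕ)
    (ht : 0 ≤ s.im) (h1 : ∀ n ∈ J, 1 ≤ n)
    (hconn : ∀ a ∈ J, ∀ b ∈ J, ∀ n, a ≤ n → n ≤ b → n ∈ J)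
    (hg : ∀ n ∈ J, k + δ ≤ s.im / (2 * Real.pi) * Real.log (1 + 1 / n) ∧
      s.im / (2 * Real.pi) * Real.log (1 + 1 / n) ≤ k + 1 - δ)
    (W : ℝ) (hW0 : 0 ≤ W) (hW : ∀ n ∈ J, (n : ℝ) ^ (-s.re) ≤ W) :
    ‖∑ n ∈ J, (n : ℂ) ^ (-s)‖ ≤ W * (1 + 1 / δ) := by
  rcases J.eq_empty_or_nonempty with rfl | hne
  · simp; positivity
  · have ha := J.min'_mem hne
    have hb := J.max'_mem hne
    set a := J.min' hne
    set b := J.max' hne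
    have hab : a ≤ b := J.min'_le _ hb
    have hJ : J = Finset.Icc a (a + (b - a)) := by
      ext n
      rw [Finset.mem_Icc]
      constructor
      · intro hn
        have := J.min'_le n hn
        have := J.le_max' n hn
        omega
      · rintro ⟨h2, h3⟩
        exact hconn a ha b hb n h2 (by omega)
    have := zb_kl s hs δ hδ k a (b - a) (h1 a ha) ht (by rw [← hJ]; exact hg)
    rw [← hJ] at this
    refine this.trans ?_
    have := hW a ha
    gcongr

lemma zb_g_bd (T : ℝ) (hT : 0 ≤ T) (n : ℕ) (hn : 1 ≤ n) :
    T / (n + 1) ≤ T * Real.log (1 + 1 / n) ∧ T * Real.log (1 + 1 / n) ≤ T / n := by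
  have p : (0:ℝ) < n := by exact_mod_cast hn
  constructor
  · have := Real.one_sub_inv_le_log_of_pos (x := 1 + 1 / (n:ℝ)) (by positivity)
    have e : 1 - (1 + 1/(n:ℝ))⁻¹ = 1 / (n+1) := by field_simp; ring
    rw [e] at this
    rw [div_eq_mul_one_div]
    gcongr
  · have := Real.log_le_sub_one_of_pos (x := 1 + 1 / (n:ℝ)) (by positivity)
    rw [add_sub_cancel_left] at this
    rw [div_eq_mul_one_div T]
    gcongr

lemma zb_block (s : ℂ) (hs : 1/2 ≤ s.re) (T S : ℝ) (hT : T = s.im / (2 * Real.pi))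
    (hS : 7/10 ≤ S) (hTS : T = S ^ 2) (B : ℕ) (hB : (B : ℝ) ≤ 6 * S ^ 3) (k : ℕ) (hk : (k:ℝ) ≤ S)
    (ht : 0 ≤ s.im) :
    ‖∑ n ∈ Finset.filter (fun n : ℕ => ⌊T * Real.log (1 + 1 / n)⌋₊ = k)
      ((Finset.range B).filter (fun n : ℕ => S ≤ n)), (n : ℂ) ^ (-s)‖ ≤ 28 / √(k + 1) := by
  have hS0 : 0 < S := by linarith
  have hT0 : 0 < T := by rw [hTS]; positivity
  have hk0 : (0:ℝ) ≤ k := Nat.cast_nonneg k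
  set F := Finset.filter (fun n : ℕ => ⌊T * Real.log (1 + 1 / n)⌋₊ = k)
    ((Finset.range B).filter (fun n : ℕ => S ≤ n)) with hF
  have hmem : ∀ n ∈ F, n < B ∧ S ≤ n ∧ 1 ≤ n ∧ (k:ℝ) ≤ T * Real.log (1 + 1 / n) ∧
      T * Real.log (1 + 1 / n) < k + 1 := by
    intro n hn
    simp only [hF, Finset.mem_filter, Finset.mem_range] at hn
    obtain ⟨⟨h1, h2⟩, h3⟩ := hn
    have h4 : 1 ≤ n := by
      by_contra h
      have : n = 0 := by omega
      subst this
      simp at h2; linarith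
    have h5 : 0 ≤ T * Real.log (1 + 1 / n) :=
      le_trans (by positivity) (zb_g_bd T hT0.le n h4).1
    rw [Nat.floor_eq_iff h5] at h3
    exact ⟨h1, h2, h4, h3⟩
  have hanti : ∀ a b : ℕ, 1 ≤ a → a ≤ b →
      T * Real.log (1 + 1 / b) ≤ T * Real.log (1 + 1 / a) := by
    intro a b ha hab
    have p1 : (0:ℝ) < a := by exact_mod_cast ha
    gcongr
  have hmem' : ∀ n : ℕ, n < B → S ≤ n → 1 ≤ n → (k:ℝ) ≤ T * Real.log (1 + 1 / n) →
      T * Real.log (1 + 1 / n) < k + 1 → n ∈ F := by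
    intro n h1 h2 h4 h5 h6
    simp only [hF, Finset.mem_filter, Finset.mem_range]
    exact ⟨⟨h1, h2⟩, (Nat.floor_eq_iff (hk0.trans h5)).2 ⟨h5, h6⟩⟩
  set δ : ℝ := (k + 1) / (6 * S) with hδ
  have hδ0 : 0 < δ := by positivity
  have hδk : δ ≤ (k+1) / 4 := by
    rw [hδ]; gcongr; linarith
  set W : ℝ := √2 * √(k+1) / S with hWdef
  have hW0 : 0 ≤ W := by positivity
  have hW : ∀ n ∈ F, (n:ℝ) ^ (-s.re) ≤ W := by
    intro n hn
    obtain ⟨_, _, h4, _, h6⟩ := hmem n hn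
    have p1 : (1:ℝ) ≤ n := by exact_mod_cast h4
    have h7 := (zb_g_bd T hT0.le n h4).1.trans_lt h6
    rw [div_lt_iff₀ (by positivity)] at h7
    calc (n:ℝ) ^ (-s.re) ≤ (n:ℝ) ^ (-(1/2) : ℝ) :=
          Real.rpow_le_rpow_of_exponent_le p1 (by linarith)
      _ = 1 / √n := by rw [Real.rpow_neg (by positivity), Real.sqrt_eq_rpow, one_div (_ ^ _)]
      _ ≤ W := by
        rw [hWdef, div_le_div_iff₀ (by positivity) hS0, one_mul, ← Real.sqrt_mul (by norm_num),
          ← Real.sqrt_mul (by positivity)]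
        apply Real.le_sqrt_of_sq_le
        rw [← hTS]
        nlinarith
  have hterm : ∀ n ∈ F, ‖(n:ℂ) ^ (-s)‖ ≤ W := by
    intro n hn
    rw [Complex.norm_natCast_cpow_of_pos (by have := (hmem n hn).2.2.1; omega)]
    exact hW n hn
  -- split
  set J := F.filter (fun n : ℕ => k + δ ≤ T * Real.log (1 + 1 / n) ∧
      T * Real.log (1 + 1 / n) ≤ k + 1 - δ) with hJ
  set L := F.filter (fun n : ℕ => T * Real.log (1 + 1 / n) < k + δ) with hL
  set H := F.filter (fun n : ℕ => k + 1 - δ < T * Real.log (1 + 1 / n)) with hH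
  have hgood : ‖∑ n ∈ J, (n:ℂ) ^ (-s)‖ ≤ W * (1 + 1 / δ) := by
    apply zb_good s (by linarith) δ hδ0 k J ht _ _ _ W hW0
    · intro n hn
      exact hW n (Finset.mem_filter.1 hn).1
    · intro n hn
      exact (hmem n (Finset.mem_filter.1 hn).1).2.2.1
    · intro a ha b hb n han hnb
      obtain ⟨ha1, ha2, ha3⟩ := Finset.mem_filter.1 ha
      obtain ⟨hb1, hb2, hb3⟩ := Finset.mem_filter.1 hb
      obtain ⟨a1, a2, a3, a4, a5⟩ := hmem a ha1
      obtain ⟨b1, b2, b3, b4, b5⟩ := hmem b hb1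
      have m1 := hanti a n a3 han
      have m2 := hanti n b (by omega) hnb
      have c : (a:ℝ) ≤ n := by exact_mod_cast han
      refine Finset.mem_filter.2 ⟨hmem' n (by omega) (by linarith) (by omega) (by linarith)
        (by linarith), by linarith, by linarith⟩
    · intro n hn
      rw [← hT]
      exact (Finset.mem_filter.1 hn).2
  have hbad : ∀ G ⊆ F, ‖∑ n ∈ G, (n:ℂ) ^ (-s)‖ ≤ W * G.card := by
    intro G hG
    refine (norm_sum_le_of_le G (fun n hn => hterm n (hG hn))).trans ?_
    simp [mul_comm]
  have hLc : (L.card : ℝ) ≤ 2/3 * (S / (k+1)) + 2 := by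
    rcases Nat.eq_zero_or_pos k with h0 | h0
    · have : L = ∅ := by
        apply Finset.eq_empty_of_forall_notMem
        intro n hn
        obtain ⟨hn1, hn2⟩ := Finset.mem_filter.1 hn
        obtain ⟨n1, n2, n3, n4, n5⟩ := hmem n hn1
        have h7 := (zb_g_bd T hT0.le n n3).1.trans_lt hn2
        have c : (n:ℝ) + 1 ≤ B := by exact_mod_cast n1
        rw [h0] at h7
        rw [div_lt_iff₀ (by positivity), hδ, h0, hTS] at h7
        simp only [Nat.cast_zero, zero_add] at h7
        rw [div_mul_eq_mul_div, lt_div_iff₀ (by positivity)] at h7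
        nlinarith
      rw [this]
      simp; positivity
    · have k1 : (1:ℝ) ≤ k := by exact_mod_cast h0
      have hk0' : (0:ℝ) < k := by linarith
      have hle : T / (k + δ) ≤ T / k := by gcongr; linarith
      refine (zb_card L (T / (k + δ) - 1) (T / k) (by linarith) ?_).trans ?_
      · intro n hn
        obtain ⟨hn1, hn2⟩ := Finset.mem_filter.1 hn
        obtain ⟨n1, n2, n3, n4, n5⟩ := hmem n hn1
        have c : (1:ℝ) ≤ n := by exact_mod_cast n3
        have h7 := (zb_g_bd T hT0.le n n3).1.trans_lt hn2
        have h8 := n4.trans (zb_g_bd T hT0.le n n3).2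
        rw [div_lt_iff₀ (by positivity)] at h7
        rw [le_div_iff₀ (by positivity)] at h8
        constructor
        · rw [sub_le_iff_le_add, div_le_iff₀ (by positivity)]; linarith
        · rw [le_div_iff₀ (by positivity)]; linarith
      · have e : T / k - T / (k + δ) = T * δ / (k * (k + δ)) := by field_simp; ring
        have e2 : T * δ / (k * (k + δ)) ≤ 2/3 * (S / (k+1)) := by
          have e3 : 2/3 * (S / (k+1)) = T * δ / ((k+1)^2/4) := by
            rw [hδ, hTS]; field_simp; norm_num
          rw [e3]
          gcongr
          nlinarith
        linarith
  have hHc : (H.card : ℝ) ≤ 1/3 * (S / (k+1)) + 2 := by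
    have hle : T / (k + 1) ≤ T / (k + 1 - δ) := by gcongr <;> linarith
    have p3 : 0 < k + 1 - δ := by linarith
    refine (zb_card H (T / (k + 1) - 1) (T / (k + 1 - δ)) (by linarith) ?_).trans ?_
    · intro n hn
      obtain ⟨hn1, hn2⟩ := Finset.mem_filter.1 hn
      obtain ⟨n1, n2, n3, n4, n5⟩ := hmem n hn1
      have c : (1:ℝ) ≤ n := by exact_mod_cast n3
      have h7 := (zb_g_bd T hT0.le n n3).1.trans_lt n5
      have h8 := hn2.le.trans (zb_g_bd T hT0.le n n3).2
      rw [div_lt_iff₀ (by positivity)] at h7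
      rw [le_div_iff₀ (by positivity)] at h8
      constructor
      · rw [sub_le_iff_le_add, div_le_iff₀ (by positivity)]; linarith
      · rw [le_div_iff₀ (by positivity)]; linarith
    · have e : T / (k + 1 - δ) - T / (k + 1) = T * δ / ((k + 1) * (k + 1 - δ)) := by
        field_simp; ring
      have e2 : T * δ / ((k + 1) * (k + 1 - δ)) ≤ 1/3 * (S / (k+1)) := by
        have e3 : 1/3 * (S / (k+1)) = T * δ / ((k+1) * ((k+1)/2)) := by
          rw [hδ, hTS]; field_simp; norm_num
        rw [e3]
        gcongr
        linarith
      linarith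
  have hcover : F ⊆ J ∪ (F \ J) := by intro n hn; simp; tauto
  have hLH : F \ J ⊆ L ∪ H := by
    intro n hn
    simp only [Finset.mem_sdiff, hJ, hL, hH, Finset.mem_union, Finset.mem_filter] at *
    obtain ⟨h1, h2⟩ := hn
    by_contra hc
    push Not at hc
    exact h2 ⟨h1, hc.1 h1, hc.2 h1⟩
  have hcard : ((F \ J).card : ℝ) ≤ L.card + H.card := by
    exact_mod_cast (Finset.card_le_card hLH).trans (Finset.card_union_le _ _)
  have hJF : J ⊆ F := Finset.filter_subset _ _
  rw [← Finset.sum_sdiff hJF]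
  refine (norm_add_le _ _).trans ?_
  have hb := hbad (F \ J) Finset.sdiff_subset
  have hone : 1 ≤ 5/2 * (S / (k+1)) := by
    rw [← mul_div_assoc, le_div_iff₀ (by positivity)]; linarith
  have hid : 1 / δ = 6 * (S / (k+1)) := by rw [hδ]; field_simp
  have htot : ‖∑ n ∈ F \ J, (n:ℂ) ^ (-s)‖ + ‖∑ n ∈ J, (n:ℂ) ^ (-s)‖ ≤
      W * (39/2 * (S / (k+1))) := by
    rw [hid] at hgood
    have : W * ((F \ J).card : ℝ) + W * (1 + 6 * (S / (k+1))) ≤ W * (39/2 * (S / (k+1))) := by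
      rw [← mul_add]
      gcongr
      linarith
    linarith
  refine htot.trans ?_
  have hsq : √((k:ℝ)+1) * √((k:ℝ)+1) = k + 1 := Real.mul_self_sqrt (by positivity)
  have hq : 0 < √((k:ℝ)+1) := by positivity
  have e : W * (39/2 * (S / (k+1))) = (39/2 * √2) / √((k:ℝ)+1) := by
    rw [hWdef]
    calc √2 * √((k:ℝ)+1) / S * (39/2 * (S / (k+1)))
        = √2 * √((k:ℝ)+1) / S * (39/2 * (S / (√((k:ℝ)+1) * √((k:ℝ)+1)))) := by rw [hsq]
      _ = _ := by
        generalize √((k:ℝ)+1) = q at hq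
        field_simp
  rw [e]
  gcongr
  have : √2 ≤ 1.4143 := by rw [Real.sqrt_le_iff]; norm_num
  linarith

lemma zb_sum_sqrt (K : ℕ) : ∑ k ∈ Finset.range K, 1 / √((k:ℝ) + 1) ≤ 2 * √K := by
  induction K with
  | zero => simp
  | succ K ih =>
    rw [Finset.sum_range_succ]
    have h1 : √(K:ℝ) * √(K:ℝ) = K := Real.mul_self_sqrt (by positivity)
    have h2 : √((K:ℝ)+1) * √((K:ℝ)+1) = K + 1 := Real.mul_self_sqrt (by positivity)
    have hq : 0 < √((K:ℝ)+1) := by positivity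
    have : 1 / √((K:ℝ)+1) ≤ 2 * √((K:ℝ)+1) - 2 * √K := by
      rw [div_le_iff₀ hq]
      nlinarith [sq_nonneg (√((K:ℝ)+1) - √K)]
    push_cast
    linarith

lemma zb_main_sum (s : ℂ) (hs : 1/2 ≤ s.re) (S : ℝ) (hTS : s.im / (2 * Real.pi) = S ^ 2)
    (hS : 7/10 ≤ S) (B : ℕ) (hB : (B : ℝ) ≤ 6 * S ^ 3) (ht : 0 ≤ s.im) :
    ‖∑ n ∈ Finset.range B, (n : ℂ) ^ (-s)‖ ≤ 100 * √S := by
  have hS0 : 0 < S := by linarith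
  have hsne : -s ≠ 0 := by
    intro h
    have : s = 0 := by simpa using h
    rw [this] at hs; norm_num at hs
  rw [← Finset.sum_filter_add_sum_filter_not (Finset.range B) (fun n : ℕ => S ≤ n)]
  refine (norm_add_le _ _).trans ?_
  set K := ⌊S⌋₊ + 1 with hK
  have hKS : √(K:ℝ) ≤ 16/10 * √S := by
    have h1 : (K:ℝ) ≤ (16/10)^2 * S := by
      have := Nat.floor_le hS0.le
      rw [hK]; push_cast; linarith
    calc √(K:ℝ) ≤ √((16/10)^2 * S) := Real.sqrt_le_sqrt h1
      _ = 16/10 * √S := by rw [Real.sqrt_mul (by positivity), Real.sqrt_sq (by positivity)]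
  have hbig : ‖∑ n ∈ (Finset.range B).filter (fun n : ℕ => S ≤ n), (n : ℂ) ^ (-s)‖ ≤
      28 * (2 * √K) := by
    have hmaps : ∀ n ∈ (Finset.range B).filter (fun n : ℕ => S ≤ n),
        ⌊S^2 * Real.log (1 + 1 / n)⌋₊ ∈ Finset.range K := by
      intro n hn
      have h1 := (Finset.mem_filter.1 hn).2
      have h2 : 1 ≤ n := by
        by_contra h
        have : n = 0 := by omega
        subst this
        simp at h1; linarith
      rw [Finset.mem_range, hK, Nat.lt_succ_iff]
      apply Nat.floor_le_floor
      refine (zb_g_bd (S^2) (by positivity) n h2).2.trans ?_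
      rw [div_le_iff₀ (by linarith)]
      nlinarith
    rw [← Finset.sum_fiberwise_of_maps_to hmaps]
    refine (norm_sum_le _ _).trans ?_
    refine le_trans (Finset.sum_le_sum (g := fun k : ℕ => 28 * (1 / √((k:ℝ)+1))) ?_) ?_
    · intro k hk
      rw [Finset.mem_range, hK, Nat.lt_succ_iff, Nat.le_floor_iff hS0.le] at hk
      have := zb_block s hs (S^2) S hTS.symm hS rfl B hB k hk ht
      rw [← mul_div_assoc, mul_one]
      exact this
    · rw [← Finset.mul_sum]
      gcongr
      exact zb_sum_sqrt K
  have hsmall : ‖∑ n ∈ (Finset.range B).filter (fun n : ℕ => ¬ S ≤ n), (n : ℂ) ^ (-s)‖ ≤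
      2 * √K := by
    refine (norm_sum_le _ _).trans ?_
    have hsub : (Finset.range B).filter (fun n : ℕ => ¬ S ≤ n) ⊆ Finset.range (K + 1) := by
      intro n hn
      have h1 := (Finset.mem_filter.1 hn).2
      have : (n:ℝ) < K + 1 := by
        have := Nat.lt_floor_add_one S
        rw [hK]; push_cast; linarith
      rw [Finset.mem_range]
      exact_mod_cast this
    refine (Finset.sum_le_sum_of_subset_of_nonneg hsub (fun _ _ _ => norm_nonneg _)).trans ?_
    rw [Finset.sum_range_succ']
    rw [Nat.cast_zero, Complex.zero_cpow hsne, norm_zero, add_zero]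
    refine le_trans (Finset.sum_le_sum ?_) (zb_sum_sqrt K)
    intro n _
    rw [Complex.norm_natCast_cpow_of_pos (by omega)]
    calc ((n+1:ℕ):ℝ) ^ (-s).re ≤ ((n+1:ℕ):ℝ) ^ (-(1/2) : ℝ) :=
          Real.rpow_le_rpow_of_exponent_le (by push_cast; linarith [(Nat.cast_nonneg n : (0:ℝ) ≤ n)])
            (by rw [neg_re]; linarith)
      _ = 1 / √((n:ℝ)+1) := by
          rw [Real.rpow_neg (by positivity), Real.sqrt_eq_rpow, one_div (_ ^ _)]; push_cast; rfl
  have : 0 ≤ √S := by positivity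
  linarith

lemma zb_cpow_deriv (r : ℂ) (hr : r ≠ 0) (x : ℝ) (hx : 0 < x) :
    HasDerivAt (fun y : ℝ => (y : ℂ) ^ r) (r * (x : ℂ) ^ (r - 1)) x := by
  have := hasDerivAt_ofReal_cpow_const' (x := x) hx.ne' (r := r - 1)
    (by intro h; apply hr; linear_combination h)
  rw [sub_add_cancel] at this
  have h2 := this.const_mul r
  refine (h2.congr_of_eventuallyEq ?_)
  filter_upwards with y
  field_simp

lemma zb_inner (s : ℂ) (hs : 0 < s.re) (a b : ℝ) (ha : 0 < a) :
    ∀ x ∈ Set.Icc a b, ‖(a : ℂ) ^ (-s) - (x : ℂ) ^ (-s)‖ ≤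
      ‖s‖ / s.re * (a ^ (-s.re) - x ^ (-s.re)) := by
  have hsne : s ≠ 0 := by rintro rfl; simp at hs
  intro x hx
  refine image_norm_le_of_norm_deriv_right_le_deriv_boundary' (a := a) (b := b)
    (f := fun x : ℝ => (a : ℂ) ^ (-s) - (x : ℂ) ^ (-s))
    (B := fun x : ℝ => ‖s‖ / s.re * (a ^ (-s.re) - x ^ (-s.re)))
    (f' := fun x => s * (x : ℂ) ^ (-s - 1)) (B' := fun x => ‖s‖ * x ^ (-s.re - 1))
    ?_ ?_ ?_ ?_ ?_ ?_ hx
  · intro x hx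
    have hx0 : 0 < x := ha.trans_le hx.1
    have := ((zb_cpow_deriv (-s) (neg_ne_zero.2 hsne) x hx0).const_sub ((a:ℂ) ^ (-s)))
    exact this.continuousAt.continuousWithinAt
  · intro x hx
    have hx0 : 0 < x := ha.trans_le hx.1
    have := ((zb_cpow_deriv (-s) (neg_ne_zero.2 hsne) x hx0).const_sub ((a:ℂ) ^ (-s)))
    refine HasDerivAt.hasDerivWithinAt ?_
    convert this using 1
    ring
  · simp
  · intro x hx
    have hx0 : 0 < x := ha.trans_le hx.1
    have := (((Real.hasDerivAt_rpow_const (x := x) (p := -s.re) (Or.inl hx0.ne')).const_sub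
      (a ^ (-s.re))).const_mul (‖s‖ / s.re))
    exact this.continuousAt.continuousWithinAt
  · intro x hx
    have hx0 : 0 < x := ha.trans_le hx.1
    have := (((Real.hasDerivAt_rpow_const (x := x) (p := -s.re) (Or.inl hx0.ne')).const_sub
      (a ^ (-s.re))).const_mul (‖s‖ / s.re))
    refine HasDerivAt.hasDerivWithinAt ?_
    refine this.congr_deriv ?_
    have h0 : s.re ≠ 0 := hs.ne'
    generalize x ^ (-s.re - 1) = y
    field_simp
  · intro x hx
    have hx0 : 0 < x := ha.trans_le hx.1
    rw [norm_mul, Complex.norm_cpow_eq_rpow_re_of_pos hx0]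
    simp

noncomputable def zbTerm (n : ℕ) (s : ℂ) : ℂ :=
  (n : ℂ) ^ (-s) - ((n : ℂ) ^ (1 - s) - ((n + 1 : ℕ) : ℂ) ^ (1 - s)) / (s - 1)

lemma zb_term_bd (n : ℕ) (hn : 1 ≤ n) (s : ℂ) (hs : 0 < s.re) (h1 : s ≠ 1) :
    ‖zbTerm n s‖ ≤ ‖s‖ / s.re * ((n:ℝ) ^ (-s.re) - ((n + 1 : ℕ) : ℝ) ^ (-s.re)) := by
  have hn0 : (0:ℝ) < n := by exact_mod_cast hn
  have h1' : s - 1 ≠ 0 := sub_ne_zero.2 h1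
  have h1'' : 1 - s ≠ 0 := sub_ne_zero.2 (Ne.symm h1)
  set h : ℝ → ℂ := fun x => ((x:ℂ) - n) * (n : ℂ) ^ (-s) -
    ((n : ℂ) ^ (1 - s) - (x : ℂ) ^ (1 - s)) / (s - 1) with hh
  have hd : ∀ x ∈ Set.Icc (n:ℝ) ((n:ℝ)+1), HasDerivWithinAt h ((n : ℂ) ^ (-s) - (x : ℂ) ^ (-s))
      (Set.Icc (n:ℝ) ((n:ℝ)+1)) x := by
    intro x hx
    have hx0 : 0 < x := hn0.trans_le hx.1
    have d1 : HasDerivAt (fun y : ℝ => (y:ℂ)) 1 x := Complex.ofRealCLM.hasDerivAt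
    have d2 := (d1.sub_const (n:ℂ)).mul_const ((n : ℂ) ^ (-s))
    have d3 := ((zb_cpow_deriv (1-s) h1'' x hx0).const_sub ((n : ℂ) ^ (1 - s))).div_const (s-1)
    refine HasDerivAt.hasDerivWithinAt ?_
    refine (d2.fun_sub d3).congr_deriv ?_
    have : (1 - s - 1) = -s := by ring
    rw [this]
    field_simp
    ring
  have key := (convex_Icc (n:ℝ) ((n:ℝ)+1)).norm_image_sub_le_of_norm_hasDerivWithin_le
    (C := ‖s‖ / s.re * ((n:ℝ) ^ (-s.re) - ((n + 1 : ℕ) : ℝ) ^ (-s.re))) hd ?_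
    (x := (n:ℝ)) (y := (n:ℝ)+1) (by simp) (by simp)
  · have e : h ((n:ℝ)+1) - h n = zbTerm n s := by
      simp only [hh, zbTerm]
      push_cast
      ring
    rw [e] at key
    simpa using key
  · intro x hx
    have hx0 : 0 < x := hn0.trans_le hx.1
    refine (zb_inner s hs n (n+1) hn0 x hx).trans ?_
    have : ((n + 1 : ℕ) : ℝ) ^ (-s.re) ≤ x ^ (-s.re) := by
      apply Real.rpow_le_rpow_of_nonpos hx0
      · push_cast; exact hx.2
      · linarith
    gcongr

lemma zb_tele (N : ℕ) (σ : ℝ) (hσ : 0 < σ) (hN : 1 ≤ N) :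
    HasSum (fun n : ℕ => ((n + N : ℕ):ℝ) ^ (-σ) - ((n + N + 1 : ℕ) : ℝ) ^ (-σ)) ((N:ℝ) ^ (-σ)) := by
  rw [hasSum_iff_tendsto_nat_of_nonneg]
  · have h1 : ∀ m : ℕ, ∑ n ∈ Finset.range m, (((n + N : ℕ):ℝ) ^ (-σ) - ((n + N + 1 : ℕ) : ℝ) ^ (-σ))
        = (N:ℝ) ^ (-σ) - ((m + N : ℕ):ℝ) ^ (-σ) := by
      intro m
      have := Finset.sum_range_sub' (fun n : ℕ => ((n + N : ℕ):ℝ) ^ (-σ)) m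
      simp only [zero_add] at this
      rw [← this]
      apply Finset.sum_congr rfl
      intro n _
      rw [add_right_comm]
    simp_rw [h1]
    have h2 : Filter.Tendsto (fun m : ℕ => ((m + N : ℕ):ℝ) ^ (-σ)) Filter.atTop (nhds 0) :=
      (tendsto_rpow_neg_atTop hσ).comp (tendsto_natCast_atTop_atTop.comp
        (Filter.tendsto_add_atTop_nat N))
    simpa using h2.const_sub ((N:ℝ) ^ (-σ))
  · intro n
    rw [sub_nonneg]
    apply Real.rpow_le_rpow_of_nonpos
    · exact_mod_cast (by omega)
    · push_cast; linarith
    · linarith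

lemma zb_summable (N : ℕ) (hN : 1 ≤ N) (s : ℂ) (hs : 0 < s.re) (h1 : s ≠ 1) :
    Summable (fun n : ℕ => zbTerm (n + N) s) :=
  Summable.of_norm_bounded ((zb_tele N s.re hs hN).mul_left (‖s‖ / s.re)).summable
    (fun n => zb_term_bd (n + N) (by omega) s hs h1)

lemma zb_tail (N : ℕ) (hN : 1 ≤ N) (s : ℂ) (hs : 0 < s.re) (h1 : s ≠ 1) :
    ‖∑' n : ℕ, zbTerm (n + N) s‖ ≤ ‖s‖ / s.re * (N:ℝ) ^ (-s.re) :=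
  tsum_of_norm_bounded ((zb_tele N s.re hs hN).mul_left (‖s‖ / s.re))
    (fun n => zb_term_bd (n + N) (by omega) s hs h1)

lemma zb_diff_rpow (n : ℕ) (hn : 1 ≤ n) (σ : ℝ) (hσ : 0 < σ) :
    (n:ℝ) ^ (-σ) - ((n + 1 : ℕ) : ℝ) ^ (-σ) ≤ σ * (n:ℝ) ^ (-σ - 1) := by
  have hn0 : (0:ℝ) < n := by exact_mod_cast hn
  have e1 : ((n + 1 : ℕ) : ℝ) = n * (1 + 1 / n) := by push_cast; field_simp
  have p : (0:ℝ) < 1 + 1 / n := by positivity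
  rw [e1, Real.mul_rpow hn0.le p.le, Real.rpow_sub_one hn0.ne']
  have h1 : 1 - σ / n ≤ (1 + 1 / (n:ℝ)) ^ (-σ) := by
    rw [Real.rpow_def_of_pos p]
    have h2 := Real.add_one_le_exp (Real.log (1 + 1 / (n:ℝ)) * -σ)
    have h3 := Real.log_le_sub_one_of_pos p
    have h4 : σ * Real.log (1 + 1 / (n:ℝ)) ≤ σ * (1 / n) := by
      gcongr; linarith
    have h5 : σ / n = σ * (1 / n) := by ring
    linarith
  have h6 : 0 ≤ (n:ℝ) ^ (-σ) := by positivity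
  have h7 : σ * ((n:ℝ) ^ (-σ) / n) = (n:ℝ) ^ (-σ) * (σ / n) := by ring
  rw [h7]
  nlinarith

lemma zb_zeta_gt_one (N : ℕ) (hN : 1 ≤ N) (s : ℂ) (hs : 1 < s.re) :
    riemannZeta s = ∑ n ∈ Finset.range N, (n : ℂ) ^ (-s) + (N : ℂ) ^ (1 - s) / (s - 1) +
      ∑' n : ℕ, zbTerm (n + N) s := by
  have h1 : s ≠ 1 := by rintro rfl; simp at hs
  have e : ∀ n : ℕ, 1 / (n : ℂ) ^ s = (n : ℂ) ^ (-s) := by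
    intro n; rw [Complex.cpow_neg, one_div]
  have hsm : Summable (fun n : ℕ => (n : ℂ) ^ (-s)) := by
    have := Complex.summable_one_div_nat_cpow.2 hs
    simpa only [e] using this
  rw [zeta_eq_tsum_one_div_nat_cpow hs]
  simp only [e]
  rw [← hsm.sum_add_tsum_nat_add N]
  have hsm2 : Summable (fun n : ℕ => ((n + N : ℕ) : ℂ) ^ (-s)) := (summable_nat_add_iff N).2 hsm
  have hst := zb_summable N hN s (by linarith) h1
  have hd := hsm2.sub hst
  set a : ℕ → ℂ := fun n => ((n + N : ℕ) : ℂ) ^ (1 - s) / (s - 1) with ha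
  have hde : (fun n : ℕ => ((n + N : ℕ) : ℂ) ^ (-s) - zbTerm (n + N) s) =
      fun n => a n - a (n+1) := by
    funext n
    simp only [zbTerm, ha]
    rw [add_right_comm n 1 N]
    ring
  have hlim := hd.hasSum.tendsto_sum_nat
  have ha0 : Filter.Tendsto a Filter.atTop (nhds 0) := by
    have h2 : Filter.Tendsto (fun m : ℕ => ((m + N : ℕ):ℝ) ^ (-(s.re - 1)) / ‖s - 1‖)
        Filter.atTop (nhds (0 / ‖s - 1‖)) :=
      ((tendsto_rpow_neg_atTop (by linarith : 0 < s.re - 1)).comp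
        (tendsto_natCast_atTop_atTop.comp (Filter.tendsto_add_atTop_nat N))).div_const _
    rw [zero_div] at h2
    rw [tendsto_zero_iff_norm_tendsto_zero]
    refine h2.congr ?_
    intro m
    simp only [ha]
    rw [norm_div, Complex.norm_natCast_cpow_of_pos (by omega)]
    congr 2
    simp
  have hlim2 : Filter.Tendsto (fun m : ℕ => ∑ n ∈ Finset.range m,
      (((n + N : ℕ) : ℂ) ^ (-s) - zbTerm (n + N) s)) Filter.atTop (nhds (a 0)) := by
    have : ∀ m : ℕ, ∑ n ∈ Finset.range m, (((n + N : ℕ) : ℂ) ^ (-s) - zbTerm (n + N) s) =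
        a 0 - a m := by
      intro m
      rw [← Finset.sum_range_sub' a m]
      apply Finset.sum_congr rfl
      intro n _
      exact congrFun hde n
    simp_rw [this]
    simpa using ha0.const_sub (a 0)
  have heq := tendsto_nhds_unique hlim hlim2
  rw [hsm2.tsum_sub hst] at heq
  have ha00 : a 0 = (N : ℂ) ^ (1 - s) / (s - 1) := by simp [ha]
  rw [ha00] at heq
  linear_combination heq

lemma zb_zeta (N : ℕ) (hN : 1 ≤ N) (s : ℂ) (hs : 1/2 ≤ s.re) (ht : 0 < s.im) :
    riemannZeta s = ∑ n ∈ Finset.range N, (n : ℂ) ^ (-s) + (N : ℂ) ^ (1 - s) / (s - 1) +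
      ∑' n : ℕ, zbTerm (n + N) s := by
  set R : ℝ := ‖s‖ + 10 with hR
  have hR0 : 0 < R := by positivity
  set U : Set ℂ := ({z : ℂ | 1/4 < z.re} ∩ {z : ℂ | 0 < z.im}) ∩ Metric.ball 0 R with hU
  have hUo : IsOpen U :=
    ((isOpen_lt continuous_const continuous_re).inter
      (isOpen_lt continuous_const continuous_im)).inter Metric.isOpen_ball
  have hUc : Convex ℝ U :=
    ((convex_halfSpace_re_gt _).inter (convex_halfSpace_im_gt _)).inter (convex_ball _ _)
  have hne1 : ∀ z ∈ U, z ≠ 1 := by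
    rintro z ⟨⟨_, h⟩, _⟩ rfl
    simp at h
  have hdiffN : ∀ n : ℕ, 1 ≤ n → Differentiable ℂ (fun z : ℂ => (n:ℂ) ^ (-z)) := by
    intro n hn z
    exact (differentiableAt_id.neg).const_cpow (Or.inl (by exact_mod_cast (by omega)))
  have hdiffN1 : ∀ n : ℕ, 1 ≤ n → Differentiable ℂ (fun z : ℂ => (n:ℂ) ^ (1-z)) := by
    intro n hn z
    exact (differentiableAt_id.const_sub 1).const_cpow (Or.inl (by exact_mod_cast (by omega)))
  have hsubd : Differentiable ℂ (fun z : ℂ => z - 1) := differentiable_id.sub_const 1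
  have hf1 : DifferentiableOn ℂ riemannZeta U := fun z hz =>
    (differentiableAt_riemannZeta (hne1 z hz)).differentiableWithinAt
  have hz0 : ∀ z ∈ U, z ≠ 0 := by
    rintro z ⟨⟨_, h⟩, _⟩ rfl
    simp at h
  have hf2a : DifferentiableOn ℂ (fun z : ℂ => ∑ n ∈ Finset.range N, (n : ℂ) ^ (-z)) U := by
    apply DifferentiableOn.fun_sum
    intro n _ z hz
    exact ((differentiableAt_id.neg).const_cpow
      (Or.inr (by simpa using hz0 z hz))).differentiableWithinAt
  have hf2b : DifferentiableOn ℂ (fun z : ℂ => (N : ℂ) ^ (1 - z) / (z - 1)) U :=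
    (hdiffN1 N hN).differentiableOn.div hsubd.differentiableOn
      (fun z hz => sub_ne_zero.2 (hne1 z hz))
  have hf2c : DifferentiableOn ℂ (fun z : ℂ => ∑' n : ℕ, zbTerm (n + N) z) U := by
    apply differentiableOn_tsum_of_summable_norm
      (u := fun n : ℕ => R * (((n + N : ℕ):ℝ) ^ (-(5/4) : ℝ))) _ _ hUo _
    · apply Summable.mul_left
      have : Summable (fun n : ℕ => (n:ℝ) ^ (-(5/4) : ℝ)) :=
        Real.summable_nat_rpow.2 (by norm_num)
      exact (summable_nat_add_iff N).2 this
    · intro n z hz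
      have hz1 := sub_ne_zero.2 (hne1 z hz)
      refine DifferentiableAt.differentiableWithinAt ?_
      exact ((hdiffN (n+N) (by omega)) z).sub
        ((((hdiffN1 (n+N) (by omega)) z).sub ((hdiffN1 (n+N+1) (by omega)) z)).div (hsubd z) hz1)
    · intro n z hz
      have hz1 := hne1 z hz
      obtain ⟨⟨h1, h2⟩, h3⟩ := hz
      simp only [Set.mem_ofPred_eq] at h1 h2
      rw [mem_ball_zero_iff] at h3
      have h0 : 0 < z.re := by linarith
      refine (zb_term_bd (n+N) (by omega) z h0 hz1).trans ?_
      have h4 := zb_diff_rpow (n+N) (by omega) z.re h0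
      have h5 : ((n + N : ℕ):ℝ) ^ (-z.re - 1) ≤ ((n + N : ℕ):ℝ) ^ (-(5/4) : ℝ) :=
        Real.rpow_le_rpow_of_exponent_le (by exact_mod_cast (by omega)) (by linarith)
      calc ‖z‖ / z.re * (((n + N : ℕ):ℝ) ^ (-z.re) - ((n + N + 1 : ℕ) : ℝ) ^ (-z.re))
          ≤ ‖z‖ / z.re * (z.re * ((n + N : ℕ):ℝ) ^ (-z.re - 1)) := by gcongr
        _ = ‖z‖ * ((n + N : ℕ):ℝ) ^ (-z.re - 1) := by field_simp
        _ ≤ _ := by gcongr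
  have hf2 := (hf2a.add hf2b).add hf2c
  have hz2 : (2 + I : ℂ) ∈ U := by
    refine ⟨⟨by simp; norm_num, by simp⟩, ?_⟩
    rw [mem_ball_zero_iff]
    have := norm_add_le (2:ℂ) I
    rw [norm_I, Complex.norm_ofNat] at this
    have := norm_nonneg s
    linarith
  have hsU : s ∈ U := by
    refine ⟨⟨?_, ht⟩, ?_⟩
    · simp only [Set.mem_ofPred_eq]; linarith
    · rw [mem_ball_zero_iff]; linarith
  have := (hf1.analyticOnNhd hUo).eqOn_of_preconnected_of_eventuallyEq
    (hf2.analyticOnNhd hUo) hUc.isPreconnected hz2 ?_ hsU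
  · exact this
  · have : {z : ℂ | 1 < z.re} ∈ nhds (2 + I : ℂ) :=
      (isOpen_lt continuous_const continuous_re).mem_nhds (by simp)
    filter_upwards [this] with z hz
    exact zb_zeta_gt_one N hN z hz

theorem zeta_bound_quarter_power :
    ∃ C : ℝ, 0 < C ∧ ∀ s : ℂ, 1/2 ≤ s.re → Real.pi ≤ s.im →
      ‖riemannZeta s‖ ≤ C * s.im ^ ((1:ℝ)/4) := by
  refine ⟨117, by norm_num, ?_⟩
  intro s hs hπ
  have hp := Real.pi_pos
  have hp3 := Real.pi_gt_three
  have hp4 := Real.pi_lt_d2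
  have ht : 0 < s.im := by linarith
  set T := s.im / (2 * Real.pi) with hT
  have hT2 : 1/2 ≤ T := by rw [hT, le_div_iff₀ (by positivity)]; linarith
  have htT : s.im = 2 * Real.pi * T := by rw [hT]; field_simp
  set S := √T with hSdef
  have hS2 : S ^ 2 = T := Real.sq_sqrt (by linarith)
  have hS : 7/10 ≤ S := by apply Real.le_sqrt_of_sq_le; norm_num; linarith
  have hS0 : 0 < S := by linarith
  set N := ⌊6 * S ^ 3⌋₊ with hN
  have hS3 : (7/10)^3 ≤ S ^ 3 := by gcongr
  have hNle : (N:ℝ) ≤ 6 * S ^ 3 := Nat.floor_le (by positivity)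
  have hNge : 3 * S ^ 3 ≤ N := by
    have := Nat.lt_floor_add_one (6 * S ^ 3)
    norm_num at hS3
    linarith
  have hN1' : (1:ℝ) ≤ N := by norm_num at hS3; linarith
  have hN1 : 1 ≤ N := by exact_mod_cast hN1'
  have hs1 : s ≠ 1 := by rintro rfl; simp at ht
  set r := √S with hr
  have hr0 : 0 < r := Real.sqrt_pos.2 hS0
  have hrr : r * r = S := Real.mul_self_sqrt hS0.le
  have b1 := zb_main_sum s hs S hS2.symm hS N hNle ht.le
  have b2 : ‖(N : ℂ) ^ (1 - s) / (s - 1)‖ ≤ r := by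
    rw [norm_div, Complex.norm_natCast_cpow_of_pos (by omega)]
    have c1 : (N:ℝ) ^ (1 - s).re ≤ 3 * S * r := by
      calc (N:ℝ) ^ (1 - s).re ≤ (N:ℝ) ^ ((1:ℝ)/2) :=
            Real.rpow_le_rpow_of_exponent_le hN1' (by simp; linarith)
        _ = √N := by rw [Real.sqrt_eq_rpow]
        _ ≤ 3 * S * r := by
          rw [Real.sqrt_le_left (by positivity)]
          have : (3 * S * r)^2 = 9 * S ^ 3 := by rw [← hrr]; ring
          rw [this]
          have : 0 < S ^ 3 := by positivity
          linarith
    have c2 : 6 * S ^ 2 ≤ ‖s - 1‖ := by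
      have := Complex.abs_im_le_norm (s - 1)
      simp only [sub_im, one_im, sub_zero] at this
      have := le_abs_self s.im
      have : 6 * S ^ 2 ≤ s.im := by rw [htT, hS2]; nlinarith
      linarith
    rw [div_le_iff₀ (by nlinarith)]
    have : 3 * S * r ≤ r * (6 * S ^ 2) := by nlinarith [mul_pos hS0 hr0]
    have : r * (6 * S ^ 2) ≤ r * ‖s - 1‖ := by gcongr
    linarith
  have b3 : ‖∑' n : ℕ, zbTerm (n + N) s‖ ≤ 16 * r := by
    refine (zb_tail N hN1 s (by linarith) hs1).trans ?_
    have c1 : ‖s‖ / s.re ≤ 16 * S ^ 2 := by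
      rw [div_le_iff₀ (by linarith)]
      have d1 := Complex.norm_le_abs_re_add_abs_im s
      rw [abs_of_pos (by linarith : 0 < s.re), abs_of_pos ht] at d1
      have d2 : s.im ≤ 6.3 * S^2 := by rw [htT, hS2]; nlinarith
      nlinarith
    have c2 : (N:ℝ) ^ (-s.re) ≤ 1 / (S * r) := by
      calc (N:ℝ) ^ (-s.re) ≤ (N:ℝ) ^ (-(1/2) : ℝ) :=
            Real.rpow_le_rpow_of_exponent_le hN1' (by linarith)
        _ = 1 / √N := by rw [Real.rpow_neg (by positivity), Real.sqrt_eq_rpow, one_div (_ ^ _)]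
        _ ≤ 1 / (S * r) := by
          gcongr
          apply Real.le_sqrt_of_sq_le
          have : (S * r)^2 = S ^ 3 := by rw [← hrr]; ring
          rw [this]
          have : 0 < S ^ 3 := by positivity
          linarith
    calc ‖s‖ / s.re * (N:ℝ) ^ (-s.re) ≤ 16 * S ^ 2 * (1 / (S * r)) := by gcongr
      _ = 16 * r := by rw [← hrr]; field_simp
  have hrt : r ≤ s.im ^ ((1:ℝ)/4) := by
    have : r = T ^ ((1:ℝ)/4) := by
      rw [hr, hSdef, Real.sqrt_eq_rpow, Real.sqrt_eq_rpow, ← Real.rpow_mul (by linarith)]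
      norm_num
    rw [this]
    apply Real.rpow_le_rpow (by linarith) _ (by norm_num)
    rw [htT]; nlinarith
  rw [zb_zeta N hN1 s hs ht]
  have n1 := norm_add_le (∑ n ∈ Finset.range N, (n : ℂ) ^ (-s) + (N : ℂ) ^ (1 - s) / (s - 1))
    (∑' n : ℕ, zbTerm (n + N) s)
  have n2 := norm_add_le (∑ n ∈ Finset.range N, (n : ℂ) ^ (-s)) ((N : ℂ) ^ (1 - s) / (s - 1))
  linarith
end
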